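/- arXiv:0810.4039 — 2 statements merged into one kernel-verified Lean document; each statement's English description precedes it below -/
import Mathlib

section
/- Let (K,d) be a differential field of characteristic 0 and let (M,∂) be a differential module over K of dimension 4 with det M = 1. Then M is isomorphic, as a differential module, to A ⊗ B for differential modules A, B over K of dimension 2 with det A = det B = 1 if and only if there exists F ∈ Sym²M with ∂F = 0 such that the symmetric bilinear form on M* determined by F is nondegenerate and admits a totally isotropic subspace of dimension 2. -/
open Module

/-- `d` is a derivation on the field `K`. -/
def IsDeriv {K : Type} [Field K] (d : K → K) : Prop :=
  (∀ a b, d (a + b) = d a + d b) ∧ (∀ a b, d (a * b) = d a * b + a * d b)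

/-- `D` is a differential-module structure on `M` over the differential field `(K, d)`. -/
def IsDiff {K : Type} [Field K] (d : K → K) {M : Type} [AddCommGroup M] [Module K M]
    (D : M → M) : Prop :=
  (∀ x y, D (x + y) = D x + D y) ∧ (∀ (a : K) (m : M), D (a • m) = d a • m + a • D m)

/-- `det M = 1`: the matrix of `D` in some basis of `M` has trace `0`. -/
def TraceZero (K : Type) [Field K] {M : Type} [AddCommGroup M] [Module K M]
    (D : M → M) (n : ℕ) : Prop :=
  ∃ (b : Basis (Fin n) K M) (A : Matrix (Fin n) (Fin n) K),
    (∀ i, D (b i) = ∑ j, A j i • b j) ∧ Matrix.trace A = 0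

/-- The induced differential structure on the dual module. -/
def dualD {K : Type} [Field K] {d : K → K} {M : Type} [AddCommGroup M] [Module K M]
    {D : M → M} (hd : IsDeriv d) (hD : IsDiff d D) (φ : Module.Dual K M) :
    Module.Dual K M where
  toFun m := d (φ m) - φ (D m)
  map_add' x y := by
    simp only [map_add, hd.1, hD.1]; ring
  map_smul' a m := by
    simp only [map_smul, hD.2, map_add, smul_eq_mul, hd.2, RingHom.id_apply]; ring

/-- `M` is an irreducible differential module. -/
def IsIrr (K : Type) [Field K] {M : Type} [AddCommGroup M] [Module K M]
    (D : M → M) : Prop :=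
  (∃ m : M, m ≠ 0) ∧ ∀ W : Submodule K M, (∀ x ∈ W, D x ∈ W) → W = ⊥ ∨ W = ⊤

theorem IsDeriv.zero {K : Type} [Field K] {d : K → K} (hd : IsDeriv d) : d 0 = 0 := by
  have := hd.1 0 0
  simpa using this

theorem IsDeriv.one {K : Type} [Field K] {d : K → K} (hd : IsDeriv d) : d 1 = 0 := by
  have := hd.2 1 1
  simpa using this

theorem IsDeriv.neg {K : Type} [Field K] {d : K → K} (hd : IsDeriv d) (a : K) :
    d (-a) = - d a := by
  have := hd.1 a (-a)
  rw [add_neg_cancel, hd.zero] at this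
  exact (neg_eq_of_add_eq_zero_right this.symm).symm

theorem IsDeriv.sub {K : Type} [Field K] {d : K → K} (hd : IsDeriv d) (a b : K) :
    d (a - b) = d a - d b := by
  rw [sub_eq_add_neg, hd.1, hd.neg, sub_eq_add_neg]

theorem dualD_key {K : Type} [Field K] {d : K → K} {M : Type} [AddCommGroup M] [Module K M]
    {D : M → M} (hd : IsDeriv d) (hD : IsDiff d D) (φ : Module.Dual K M) (m : M) :
    d (φ m) = dualD hd hD φ m + φ (D m) := by
  simp [dualD]

theorem fwd {K : Type} [Field K] [CharZero K] (d : K → K) (hd : IsDeriv d)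
    (M : Type) [AddCommGroup M] [Module K M] [FiniteDimensional K M]
    (hdim : Module.finrank K M = 4)
    (D : M → M) (hD : IsDiff d D)
    (DA DB : (Fin 2 → K) → (Fin 2 → K))
    (hA : TraceZero K DA 2) (hB : TraceZero K DB 2)
    (β : (Fin 2 → K) →ₗ[K] (Fin 2 → K) →ₗ[K] M)
    (hβ : ∀ x y, D (β x y) = β (DA x) y + β x (DB y))
    (hs : Submodule.span K {m : M | ∃ x y, β x y = m} = ⊤) :
    (∃ B : Module.Dual K M →ₗ[K] Module.Dual K M →ₗ[K] K,
      (∀ φ ψ, B φ ψ = B ψ φ) ∧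
      (∀ φ ψ, d (B φ ψ) = B (dualD hd hD φ) ψ + B φ (dualD hd hD ψ)) ∧
      (∀ φ, (∀ ψ, B φ ψ = 0) → φ = 0) ∧
      ∃ W : Submodule K (Module.Dual K M), Module.finrank K W = 2 ∧
        ∀ φ ∈ W, ∀ ψ ∈ W, B φ ψ = 0) := by
  obtain ⟨a, P, hP, hPt⟩ := hA
  obtain ⟨b, Q, hQ, hQt⟩ := hB
  let e : Fin 4 → M := ![β (a 0) (b 0), β (a 0) (b 1), β (a 1) (b 0), β (a 1) (b 1)]
  have hespan : ⊤ ≤ Submodule.span K (Set.range e) := by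
    rw [← hs, Submodule.span_le]
    rintro _ ⟨x, y, rfl⟩
    rw [← a.sum_repr x, ← b.sum_repr y]
    have h0 : β (a 0) (b 0) ∈ Submodule.span K (Set.range e) := Submodule.subset_span ⟨0, rfl⟩
    have h1 : β (a 0) (b 1) ∈ Submodule.span K (Set.range e) := Submodule.subset_span ⟨1, rfl⟩
    have h2 : β (a 1) (b 0) ∈ Submodule.span K (Set.range e) := Submodule.subset_span ⟨2, rfl⟩
    have h3 : β (a 1) (b 1) ∈ Submodule.span K (Set.range e) := Submodule.subset_span ⟨3, rfl⟩
    simp only [Fin.sum_univ_two, map_add, map_smul, LinearMap.add_apply, LinearMap.smul_apply,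
      SetLike.mem_coe]
    exact add_mem (Submodule.smul_mem _ _ (add_mem (Submodule.smul_mem _ _ h0)
      (Submodule.smul_mem _ _ h2))) (Submodule.smul_mem _ _ (add_mem (Submodule.smul_mem _ _ h1)
      (Submodule.smul_mem _ _ h3)))
  have hli : LinearIndependent K e :=
    linearIndependent_of_top_le_span_of_card_eq_finrank hespan (by simp [hdim])
  let E : Basis (Fin 4) K M := Basis.mk hli hespan
  have hE : ∀ i, E i = e i := fun i => by simp [E]
  let F : Dual K M →ₗ[K] Dual K M →ₗ[K] K := LinearMap.mk₂ K
    (fun φ ψ => φ (e 0) * ψ (e 3) + φ (e 3) * ψ (e 0) - φ (e 1) * ψ (e 2) - φ (e 2) * ψ (e 1))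
    (by intros; simp; ring) (by intros; simp; ring) (by intros; simp; ring) (by intros; simp; ring)
  have hF : ∀ φ ψ, F φ ψ = φ (e 0) * ψ (e 3) + φ (e 3) * ψ (e 0) - φ (e 1) * ψ (e 2)
    - φ (e 2) * ψ (e 1) := fun φ ψ => rfl
  have hc : ∀ i j, E.coord i (e j) = if j = i then 1 else 0 := by
    intro i j
    rw [← hE, E.coord_apply, E.repr_self, Finsupp.single_apply]
  have hP' : P 1 1 = - P 0 0 := by
    rw [Matrix.trace_fin_two] at hPt; linear_combination hPt
  have hQ' : Q 1 1 = - Q 0 0 := by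
    rw [Matrix.trace_fin_two] at hQt; linear_combination hQt
  have hD' : ∀ i j, D (β (a i) (b j)) =
      P 0 i • β (a 0) (b j) + P 1 i • β (a 1) (b j)
      + (Q 0 j • β (a i) (b 0) + Q 1 j • β (a i) (b 1)) := by
    intro i j
    rw [hβ, hP, hQ]
    simp [Fin.sum_univ_two]
  refine ⟨F, fun φ ψ => by rw [hF, hF]; ring, ?_, ?_, ?_⟩
  · intro φ ψ
    simp only [hF, hd.sub, hd.1, hd.2, dualD_key hd hD]
    simp only [e, Matrix.cons_val, hD', map_add, map_smul, smul_eq_mul, hP', hQ']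
    ring
  · intro φ h
    apply E.ext
    intro i
    rw [hE, LinearMap.zero_apply]
    have h0 := h (E.coord 3)
    have h1 := h (E.coord 2)
    have h2 := h (E.coord 1)
    have h3 := h (E.coord 0)
    simp only [hF, hc] at h0 h1 h2 h3
    fin_cases i
    · simpa using h0
    · simpa using h1
    · simpa using h2
    · simpa using h3
  · have hl2 : LinearIndependent K ![E.coord 0, E.coord 1] := by
      rw [LinearIndependent.pair_iff]
      intro s t h
      have h0 := congrArg (fun f : Dual K M => f (e 0)) h
      have h1 := congrArg (fun f : Dual K M => f (e 1)) h
      simp only [LinearMap.add_apply, LinearMap.smul_apply, hc] at h0 h1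
      exact ⟨by simpa using h0, by simpa using h1⟩
    refine ⟨Submodule.span K (Set.range ![E.coord 0, E.coord 1]), ?_, ?_⟩
    · rw [finrank_span_eq_card hl2]; simp
    · intro φ hφ ψ hψ
      rw [Matrix.range_cons_cons_empty, Submodule.mem_span_pair] at hφ hψ
      obtain ⟨s, t, rfl⟩ := hφ
      obtain ⟨s', t', rfl⟩ := hψ
      simp only [hF, LinearMap.add_apply, LinearMap.smul_apply, hc]
      simp

theorem hyp_basis {K : Type} [Field K] [CharZero K] 
    (V : Type) [AddCommGroup V] [Module K V] [FiniteDimensional K V]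
    (hdim : Module.finrank K V = 4)
    (B : V →ₗ[K] V →ₗ[K] K)
    (hsym : ∀ φ ψ, B φ ψ = B ψ φ)
    (hnd : ∀ φ, (∀ ψ, B φ ψ = 0) → φ = 0)
    (W : Submodule K V) (hW : Module.finrank K W = 2)
    (hiso : ∀ φ ∈ W, ∀ ψ ∈ W, B φ ψ = 0) :
    ∃ f : Basis (Fin 4) K V, ∀ i j, B (f i) (f j) =
      !![0,0,0,1;0,0,-1,0;0,-1,0,0;1,0,0,0] i j := by
  let w : Basis (Fin 2) K W := Module.finBasisOfFinrankEq K W hW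
  have hinj : Function.Injective B := by
    rw [injective_iff_map_eq_zero]
    intro φ h
    exact hnd φ (fun ψ => by rw [h]; rfl)
  have hsurj : Function.Surjective B :=
    (LinearMap.injective_iff_surjective_of_finrank_eq_finrank
      (Subspace.dual_finrank_eq (K := K) (V := V)).symm).1 hinj
  have hex : ∀ g : Dual K W, ∃ ψ, ∀ x : W, B ψ x = g x := by
    intro g
    obtain ⟨g', hg'⟩ := LinearMap.exists_extend g
    obtain ⟨ψ, hψ⟩ := hsurj g'
    refine ⟨ψ, fun x => ?_⟩
    rw [hψ, ← hg']; rfl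
  obtain ⟨p, hp⟩ := hex (w.coord 0)
  obtain ⟨q, hq⟩ := hex (w.coord 1)
  obtain ⟨u, hu⟩ : ∃ u : V, u = w 0 := ⟨_, rfl⟩
  obtain ⟨v, hv⟩ : ∃ v : V, v = w 1 := ⟨_, rfl⟩
  have huW : u ∈ W := by rw [hu]; exact (w 0).2
  have hvW : v ∈ W := by rw [hv]; exact (w 1).2
  have pu : B p u = 1 := by rw [hu, hp]; simp
  have pv : B p v = 0 := by rw [hv, hp]; simp
  have qu : B q u = 0 := by rw [hu, hq]; simp
  have qv : B q v = 1 := by rw [hv, hq]; simp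
  have up : B u p = 1 := by rw [hsym, pu]
  have vp : B v p = 0 := by rw [hsym, pv]
  have uq : B u q = 0 := by rw [hsym, qu]
  have vq : B v q = 1 := by rw [hsym, qv]
  have uu := hiso u huW u huW
  have uv := hiso u huW v hvW
  have vu := hiso v hvW u huW
  have vv := hiso v hvW v hvW
  let f : Fin 4 → V := ![u, v, -(q - (B q q / 2) • v - (B p q) • u), p - (B p p / 2) • u]
  have hf : ∀ i j, B (f i) (f j) = !![0,0,0,1;0,0,-1,0;0,-1,0,0;1,0,0,0] i j := by
    have qp := hsym q p
    intro i j
    fin_cases i <;> fin_cases j <;>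
      simp [f, pu, pv, qu, qv, up, vp, uq, vq, uu, uv, vu, vv, qp] <;> ring
  have hli : LinearIndependent K f := by
    rw [Fintype.linearIndependent_iff]
    intro g hg
    have h : ∀ j, ∑ i, g i * B (f i) (f j) = 0 := by
      intro j
      have := congrArg (fun x => B x (f j)) hg
      simpa using this
    simp only [hf, Fin.sum_univ_four] at h
    have h0 := h 0
    have h1 := h 1
    have h2 := h 2
    have h3 := h 3
    simp at h0 h1 h2 h3
    intro i
    fin_cases i <;> assumption
  refine ⟨basisOfLinearIndependentOfCardEqFinrank hli (by simp [hdim]), ?_⟩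
  intro i j
  simpa using hf i j

theorem bwd {K : Type} [Field K] [CharZero K] (d : K → K) (hd : IsDeriv d)
    (M : Type) [AddCommGroup M] [Module K M] [FiniteDimensional K M]
    (hdim : Module.finrank K M = 4)
    (D : M → M) (hD : IsDiff d D) 
    (B : Module.Dual K M →ₗ[K] Module.Dual K M →ₗ[K] K)
    (hcomp : ∀ φ ψ, d (B φ ψ) = B (dualD hd hD φ) ψ + B φ (dualD hd hD ψ))
    (f : Basis (Fin 4) K (Dual K M))
    (hf : ∀ i j, B (f i) (f j) = !![0,0,0,1;0,0,-1,0;0,-1,0,0;1,0,0,0] i j) :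
    (∃ DA : (Fin 2 → K) → (Fin 2 → K), ∃ DB : (Fin 2 → K) → (Fin 2 → K),
      IsDiff d DA ∧ TraceZero K DA 2 ∧ IsDiff d DB ∧ TraceZero K DB 2 ∧
      ∃ β : (Fin 2 → K) →ₗ[K] (Fin 2 → K) →ₗ[K] M,
        (∀ x y, D (β x y) = β (DA x) y + β x (DB y)) ∧
        Submodule.span K {m : M | ∃ x y, β x y = m} = ⊤) := by
  let e : Basis (Fin 4) K M := f.dualBasis.map (Module.evalEquiv K M).symm
  have hfe : ∀ i j, f i (e j) = if i = j then 1 else 0 := by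
    intro i j
    have : f i (e j) = f.dualBasis j (f i) := by
      simp only [e, Basis.map_apply]
      exact Module.apply_evalEquiv_symm_apply (R := K) (M := M) (f i) (f.dualBasis j)
    rw [this]
    simp [Finsupp.single_apply]
  obtain ⟨m, hm⟩ : ∃ m : Fin 4 → Fin 4 → K, ∀ i j, m i j = f i (D (e j)) := ⟨_, fun _ _ => rfl⟩
  have hexp : ∀ x : M, x = ∑ i, f i x • e i := by
    intro x
    have hfr : ∀ i, f i x = e.repr x i := by
      intro i
      have h := congrArg (f i) (e.sum_repr x)
      rw [← h]
      simp only [map_sum, map_smul, hfe]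
      simp
    simp only [hfr, e.sum_repr]
  have hDe : ∀ j, D (e j) = ∑ i, m i j • e i := by
    intro j
    conv_lhs => rw [hexp (D (e j))]
    simp only [hm]
  have hdf : ∀ i, dualD hd hD (f i) = - ∑ j, m i j • f j := by
    intro i
    apply e.ext
    intro k
    have : dualD hd hD (f i) (e k) = d (f i (e k)) - f i (D (e k)) := rfl
    rw [this, ← hm, hfe]
    have h0 : d (if i = k then 1 else 0) = 0 := by split_ifs <;> simp [hd.zero, hd.one]
    rw [h0]
    simp [LinearMap.sum_apply, hfe]
  have hrel : ∀ i k, ∑ j, m i j * B (f j) (f k) + ∑ j, m k j * B (f i) (f j) = 0 := by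
    intro i k
    have h := hcomp (f i) (f k)
    have h0 : d (B (f i) (f k)) = 0 := by
      rw [hf]
      fin_cases i <;> fin_cases k <;> simp [hd.zero, hd.one, hd.neg]
    rw [h0, hdf, hdf] at h
    simp only [map_neg, LinearMap.neg_apply, map_sum, LinearMap.sum_apply, map_smul,
      LinearMap.smul_apply, smul_eq_mul] at h
    linear_combination h
  simp only [hf, Fin.sum_univ_four] at hrel
  have r00 := hrel 0 0
  have r11 := hrel 1 1
  have r22 := hrel 2 2
  have r33 := hrel 3 3
  have r01 := hrel 0 1
  have r02 := hrel 0 2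
  have r03 := hrel 0 3
  have r12 := hrel 1 2
  have r13 := hrel 1 3
  have r23 := hrel 2 3
  simp at r00 r11 r22 r33 r01 r02 r03 r12 r13 r23
  have z03 : m 0 3 = 0 := by simpa using r00
  have z12 : m 1 2 = 0 := by simpa using r11
  have z21 : m 2 1 = 0 := by simpa using r22
  have z30 : m 3 0 = 0 := by simpa using r33
  have z13 : m 1 3 = m 0 2 := by linear_combination r01
  have z23 : m 2 3 = m 0 1 := by linear_combination r02
  have z33 : m 3 3 = - m 0 0 := by linear_combination r03
  have z22 : m 2 2 = - m 1 1 := by linear_combination - r12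
  have z32 : m 3 2 = m 1 0 := by linear_combination - r13
  have z31 : m 3 1 = m 2 0 := by linear_combination - r23
  have hDe0 := hDe 0
  have hDe1 := hDe 1
  have hDe2 := hDe 2
  have hDe3 := hDe 3
  simp only [Fin.sum_univ_four, z03, z12, z21, z30, z13, z23, z33, z22, z32, z31]
    at hDe0 hDe1 hDe2 hDe3
  have gen : ∀ (p q r : K), ∃ DA : (Fin 2 → K) → (Fin 2 → K),
      IsDiff d DA ∧ TraceZero K DA 2 ∧ 
      (∀ x, DA x 0 = d (x 0) + p * x 0 + q * x 1) ∧
      (∀ x, DA x 1 = d (x 1) + r * x 0 - p * x 1) := by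
    intro p q r
    refine ⟨fun x => ![d (x 0) + p * x 0 + q * x 1, d (x 1) + r * x 0 - p * x 1], ⟨?_, ?_⟩, ?_,
      fun _ => rfl, fun _ => rfl⟩
    · intro x y
      ext i
      fin_cases i <;> simp [hd.1] <;> ring
    · intro x y
      ext i
      fin_cases i <;> simp [hd.2] <;> ring
    · refine ⟨Pi.basisFun K (Fin 2), !![p, q; r, -p], ?_, ?_⟩
      · intro i
        ext k
        fin_cases i <;> fin_cases k <;> simp [hd.zero, hd.one, Fin.sum_univ_two]
      · simp [Matrix.trace_fin_two]
  obtain ⟨DA, hA, hAt, hA0, hA1⟩ := gen ((m 0 0 + m 1 1) / 2) (m 0 2) (m 2 0)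
  obtain ⟨DB, hB, hBt, hB0, hB1⟩ := gen ((m 0 0 - m 1 1) / 2) (m 0 1) (m 1 0)
  let β : (Fin 2 → K) →ₗ[K] (Fin 2 → K) →ₗ[K] M := LinearMap.mk₂ K
    (fun x y => (x 0 * y 0) • e 0 + (x 0 * y 1) • e 1 + (x 1 * y 0) • e 2 + (x 1 * y 1) • e 3)
    (by intros; simp only [Pi.add_apply]; module)
    (by intros; simp only [Pi.smul_apply, smul_eq_mul]; module)
    (by intros; simp only [Pi.add_apply]; module)
    (by intros; simp only [Pi.smul_apply, smul_eq_mul]; module)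
  have hβ : ∀ x y, β x y = (x 0 * y 0) • e 0 + (x 0 * y 1) • e 1 + (x 1 * y 0) • e 2
    + (x 1 * y 1) • e 3 := fun _ _ => rfl
  refine ⟨DA, DB, hA, hAt, hB, hBt, β, ?_, ?_⟩
  · intro x y
    simp only [hβ, hA0, hA1, hB0, hB1, hD.1, hD.2, hd.2, hDe0, hDe1, hDe2, hDe3]
    module
  · rw [eq_top_iff, ← e.span_eq, Submodule.span_le]
    rintro _ ⟨i, rfl⟩
    apply Submodule.subset_span
    fin_cases i
    · exact ⟨![1, 0], ![1, 0], by simp [hβ]⟩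
    · exact ⟨![1, 0], ![0, 1], by simp [hβ]⟩
    · exact ⟨![0, 1], ![1, 0], by simp [hβ]⟩
    · exact ⟨![0, 1], ![0, 1], by simp [hβ]⟩

/-- **Theorem 6.2.** A `4`-dimensional differential module `M` with
`det M = 1` is isomorphic to a tensor product `A ⊗ B` of two `2`-dimensional
differential modules with `det A = det B = 1` if and only if there is `F ∈ Sym² M`
with `∂ F = 0` which, as a symmetric bilinear form on `M*`, is nondegenerate and has
a totally isotropic subspace of dimension `2`. -/
theorem stmt5 {K : Type} [Field K] [CharZero K] (d : K → K) (hd : IsDeriv d)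
    (M : Type) [AddCommGroup M] [Module K M] [FiniteDimensional K M]
    (hdim : Module.finrank K M = 4)
    (D : M → M) (hD : IsDiff d D) (hdet : TraceZero K D 4) :
    -- `M ≅ A ⊗ B` as differential modules, `dim A = dim B = 2`, `det A = det B = 1`;
    -- the isomorphism is encoded by a `∂`-compatible bilinear map `A × B → M` whose
    -- image spans `M` (hence the induced map `A ⊗ B → M` is onto, so bijective).
    (∃ DA : (Fin 2 → K) → (Fin 2 → K), ∃ DB : (Fin 2 → K) → (Fin 2 → K),
      IsDiff d DA ∧ TraceZero K DA 2 ∧ IsDiff d DB ∧ TraceZero K DB 2 ∧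
      ∃ β : (Fin 2 → K) →ₗ[K] (Fin 2 → K) →ₗ[K] M,
        (∀ x y, D (β x y) = β (DA x) y + β x (DB y)) ∧
        Submodule.span K {m : M | ∃ x y, β x y = m} = ⊤)
    ↔
    (∃ B : Module.Dual K M →ₗ[K] Module.Dual K M →ₗ[K] K,
      (∀ φ ψ, B φ ψ = B ψ φ) ∧
      (∀ φ ψ, d (B φ ψ) = B (dualD hd hD φ) ψ + B φ (dualD hd hD ψ)) ∧
      (∀ φ, (∀ ψ, B φ ψ = 0) → φ = 0) ∧
      ∃ W : Submodule K (Module.Dual K M), Module.finrank K W = 2 ∧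
        ∀ φ ∈ W, ∀ ψ ∈ W, B φ ψ = 0) := by
  constructor
  · rintro ⟨DA, DB, _, hA, _, hB, β, hβ, hs⟩
    exact fwd d hd M hdim D hD DA DB hA hB β hβ hs
  · rintro ⟨B, hsym, hcomp, hnd, W, hW, hiso⟩
    obtain ⟨f, hf⟩ := hyp_basis (Dual K M) (by rw [Subspace.dual_finrank_eq, hdim]) B hsym hnd
      W hW hiso
    exact bwd d hd M hdim D hD B hcomp f hf
end

section
/- Let (K,d) be a differential field of characteristic 0 such that for every finite field extension K' of K (equipped with the derivation extending d), every nondegenerate symmetric bilinear form on a K'-vector space of dimension at least 3 admits a nonzero isotropic vector. Let (M,∂) be an irreducible differential module over K of dimension 4 with det M = 1, and suppose Sym²M contains a 1-dimensional differential submodule L such that L^{⊗4} is isomorphic to the trivial differential module. Then there exist a finite field extension K⁺ ⊇ K of degree dividing 8, equipped with the derivation extending d, and differential modules N₁, N₂ over K⁺ of dimension 2, such that K⁺ ⊗_K M ≅ N₁ ⊗ N₂ as differential modules over K⁺. -/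
open Module

open scoped TensorProduct

set_option linter.unusedSimpArgs false

lemma IsDeriv.map_zero' {F : Type} [Field F] {d : F → F} (hd : IsDeriv d) : d 0 = 0 := by
  have := hd.1 0 0
  simpa using this

lemma IsDeriv.map_one' {F : Type} [Field F] {d : F → F} (hd : IsDeriv d) : d 1 = 0 := by
  have := hd.2 1 1
  simpa using this

lemma IsDeriv.map_neg' {F : Type} [Field F] {d : F → F} (hd : IsDeriv d) (x : F) :
    d (-x) = - d x := by
  have := hd.1 (-x) x
  rw [neg_add_cancel, hd.map_zero'] at this
  linear_combination -this

/-- A connection matrix on `F²` defines a differential module. -/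
lemma isDiff_conn {F : Type} [Field F] {d : F → F} (hd : IsDeriv d)
    (x00 x01 x10 x11 : F) :
    IsDiff d (fun x : Fin 2 → F =>
      ![d (x 0) + x00 * x 0 + x01 * x 1, d (x 1) + x10 * x 0 + x11 * x 1]) := by
  constructor
  · intro x y
    ext i
    fin_cases i <;> simp [hd.1] <;> ring
  · intro a x
    ext i
    fin_cases i <;> simp [hd.2] <;> ring

/-- A differential module with a split form is a tensor product. -/
lemma tensor_of_frame {F : Type} [Field F] {d : F → F} (hd : IsDeriv d)
    {V : Type} [AddCommGroup V] [Module F V] {D : V → V} (hD : IsDiff d D)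
    (f00 f01 f10 f11 : V) (x00 x01 x10 x11 y00 y01 y10 y11 : F)
    (h00 : D f00 = (x00 + y00) • f00 + x10 • f10 + y10 • f01)
    (h01 : D f01 = (x00 + y11) • f01 + x10 • f11 + y01 • f00)
    (h10 : D f10 = (x11 + y00) • f10 + x01 • f00 + y10 • f11)
    (h11 : D f11 = (x11 + y11) • f11 + x01 • f01 + y01 • f10)
    (hspan : ∀ W : Submodule F V, f00 ∈ W → f01 ∈ W → f10 ∈ W → f11 ∈ W → W = ⊤) :
    ∃ DN₁ : (Fin 2 → F) → (Fin 2 → F), ∃ DN₂ : (Fin 2 → F) → (Fin 2 → F),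
      IsDiff d DN₁ ∧ IsDiff d DN₂ ∧
      ∃ β : (Fin 2 → F) →ₗ[F] (Fin 2 → F) →ₗ[F] V,
        (∀ x y, D (β x y) = β (DN₁ x) y + β x (DN₂ y)) ∧
        Submodule.span F {m : V | ∃ x y, β x y = m} = ⊤ := by
  refine ⟨_, _, isDiff_conn hd x00 x01 x10 x11, isDiff_conn hd y00 y01 y10 y11,
    LinearMap.mk₂ F (fun x y => (x 0 * y 0) • f00 + (x 0 * y 1) • f01 + (x 1 * y 0) • f10
      + (x 1 * y 1) • f11) ?_ ?_ ?_ ?_, ?_, ?_⟩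
  · intro x x' y
    simp only [Pi.add_apply]
    module
  · intro c x y
    simp only [Pi.smul_apply, smul_eq_mul]
    module
  · intro x y y'
    simp only [Pi.add_apply]
    module
  · intro c x y
    simp only [Pi.smul_apply, smul_eq_mul]
    module
  · intro x y
    simp only [LinearMap.mk₂_apply, hD.1, hD.2, hd.2, h00, h01, h10, h11,
      Matrix.cons_val_zero, Matrix.cons_val_one]
    module
  · apply hspan
    · exact Submodule.subset_span ⟨![1, 0], ![1, 0], by simp⟩
    · exact Submodule.subset_span ⟨![1, 0], ![0, 1], by simp⟩
    · exact Submodule.subset_span ⟨![0, 1], ![1, 0], by simp⟩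
    · exact Submodule.subset_span ⟨![0, 1], ![0, 1], by simp⟩

/-- The core computation: a rank 4 differential module preserving a diagonal form
`s₀ b₀² + s₁ b₁² + s₂ b₂² + s₃ b₃²` up to scaling with `-s₁/s₀ = t²`, `-s₃/s₂ = r²`. -/
lemma tensor_of_diag {F : Type} [Field F] [CharZero F] {d : F → F} (hd : IsDeriv d)
    {V : Type} [AddCommGroup V] [Module F V] {D : V → V} (hD : IsDiff d D)
    (b : Fin 4 → V) (A : Fin 4 → Fin 4 → F) (s : Fin 4 → F) (a t r : F)
    (hb : ∀ i, D (b i) = ∑ j, A j i • b j)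
    (hspan : ∀ W : Submodule F V, (∀ i, b i ∈ W) → W = ⊤)
    (hs : ∀ i, s i ≠ 0)
    (hds : ∀ i, d (s i) = a * s i - 2 * A i i * s i)
    (hA : ∀ i j, i ≠ j → A i j * s j + A j i * s i = 0)
    (ht : t * t * s 0 = - s 1) (hr : r * r * s 2 = - s 3) :
    ∃ DN₁ : (Fin 2 → F) → (Fin 2 → F), ∃ DN₂ : (Fin 2 → F) → (Fin 2 → F),
      IsDiff d DN₁ ∧ IsDiff d DN₂ ∧
      ∃ β : (Fin 2 → F) →ₗ[F] (Fin 2 → F) →ₗ[F] V,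
        (∀ x y, D (β x y) = β (DN₁ x) y + β x (DN₂ y)) ∧
        Submodule.span F {m : V | ∃ x y, β x y = m} = ⊤ := by
  have s0 := hs 0
  have s1 := hs 1
  have s2 := hs 2
  have s3 := hs 3
  have t0 : t ≠ 0 := by
    rintro rfl
    apply s1
    simpa using ht.symm
  have r0 : r ≠ 0 := by
    rintro rfl
    apply s3
    simpa using hr.symm
  have dt : d t = t * (A 0 0 - A 1 1) := by
    have h := congrArg d ht
    rw [hd.2, hd.2, hd.map_neg', hds, hds] at h
    have : 2 * t * s 0 ≠ 0 := by simp [t0, s0]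
    apply mul_left_cancel₀ this
    linear_combination h + (2 * A 1 1 - a) * ht
  have dr : d r = r * (A 2 2 - A 3 3) := by
    have h := congrArg d hr
    rw [hd.2, hd.2, hd.map_neg', hds, hds] at h
    have : 2 * r * s 2 ≠ 0 := by simp [r0, s2]
    apply mul_left_cancel₀ this
    linear_combination h + (2 * A 3 3 - a) * hr
  have e1 : s 1 = - (t * t * s 0) := by rw [ht, neg_neg]
  have e3 : s 3 = - (r * r * s 2) := by rw [hr, neg_neg]
  have a10 : A 1 0 = t * t * A 0 1 := by
    apply mul_right_cancel₀ s0
    linear_combination hA 0 1 (by decide) - A 0 1 * e1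
  have a32 : A 3 2 = r * r * A 2 3 := by
    apply mul_right_cancel₀ s2
    linear_combination hA 2 3 (by decide) - A 2 3 * e3
  have a02 : A 0 2 = - (A 2 0 * s 0 / s 2) := by
    field_simp
    linear_combination hA 0 2 (by decide)
  have a03 : A 0 3 = A 3 0 * s 0 / (r * r * s 2) := by
    field_simp
    linear_combination -hA 0 3 (by decide) + A 0 3 * e3
  have a12 : A 1 2 = A 2 1 * t * t * s 0 / s 2 := by
    field_simp
    linear_combination hA 1 2 (by decide) - A 2 1 * e1
  have a13 : A 1 3 = - (A 3 1 * t * t * s 0 / (r * r * s 2)) := by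
    field_simp
    linear_combination -hA 1 3 (by decide) + A 3 1 * e1 + A 1 3 * e3
  have hb0 := hb 0
  have hb1 := hb 1
  have hb2 := hb 2
  have hb3 := hb 3
  simp only [Fin.sum_univ_four] at hb0 hb1 hb2 hb3
  refine tensor_of_frame hd hD (s 0 • (b 0 + t • b 1)) ((- s 2) • (b 2 + r • b 3))
    (b 2 + (-r) • b 3) (b 0 + (-t) • b 1)
    (a - A 0 0 + t * A 0 1)
    (-(1 / (2 * s 2)) * ((A 2 0 - t * A 2 1) + (A 3 0 - t * A 3 1) / r))
    (s 0 / 2 * ((A 2 0 + t * A 2 1) - (A 3 0 + t * A 3 1) / r))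
    (A 2 2 - r * A 2 3)
    0
    (1 / 2 * ((A 2 0 - t * A 2 1) - (A 3 0 - t * A 3 1) / r))
    (-(s 0 / (2 * s 2)) * ((A 2 0 + t * A 2 1) + (A 3 0 + t * A 3 1) / r))
    (A 0 0 - t * A 0 1 - A 2 2 + r * A 2 3)
    ?_ ?_ ?_ ?_ ?_
  · simp only [hD.1, hD.2, hb0, hb1, hb2, hb3, hds, dt, dr, hd.map_neg', a10, a32, a02, a03, a12,
      a13]
    match_scalars <;> field_simp <;> ring
  · simp only [hD.1, hD.2, hb0, hb1, hb2, hb3, hds, dt, dr, hd.map_neg', a10, a32, a02, a03, a12,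
      a13]
    match_scalars <;> field_simp <;> ring
  · simp only [hD.1, hD.2, hb0, hb1, hb2, hb3, hds, dt, dr, hd.map_neg', a10, a32, a02, a03, a12,
      a13]
    match_scalars <;> field_simp <;> ring
  · simp only [hD.1, hD.2, hb0, hb1, hb2, hb3, hds, dt, dr, hd.map_neg', a10, a32, a02, a03, a12,
      a13]
    match_scalars <;> field_simp <;> ring
  · intro W h00 h01 h10 h11
    apply hspan
    have k0 : b 0 = (1 / (2 * s 0)) • (s 0 • (b 0 + t • b 1)) + (1 / 2 : F) • (b 0 + (-t) • b 1) := by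
      match_scalars <;> field_simp <;> ring
    have k1 : b 1 = (1 / (2 * t * s 0)) • (s 0 • (b 0 + t • b 1))
        - (1 / (2 * t) : F) • (b 0 + (-t) • b 1) := by
      match_scalars <;> field_simp <;> ring
    have k2 : b 2 = (-1 / (2 * s 2)) • ((-s 2) • (b 2 + r • b 3))
        + (1 / 2 : F) • (b 2 + (-r) • b 3) := by
      match_scalars <;> field_simp <;> ring
    have k3 : b 3 = (-1 / (2 * r * s 2)) • ((-s 2) • (b 2 + r • b 3))
        - (1 / (2 * r) : F) • (b 2 + (-r) • b 3) := by
      match_scalars <;> field_simp <;> ring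
    intro i
    fin_cases i
    · change b 0 ∈ W
      rw [k0]
      exact W.add_mem (W.smul_mem _ h00) (W.smul_mem _ h11)
    · change b 1 ∈ W
      rw [k1]
      exact W.sub_mem (W.smul_mem _ h00) (W.smul_mem _ h11)
    · change b 2 ∈ W
      rw [k2]
      exact W.add_mem (W.smul_mem _ h01) (W.smul_mem _ h10)
    · change b 3 ∈ W
      rw [k3]
      exact W.sub_mem (W.smul_mem _ h01) (W.smul_mem _ h10)

/-- Adjoining a square root. -/
lemma exists_sqrt_ext {K : Type} [Field K] (x : K) :
    ∃ (K' : Type) (_ : Field K') (_ : Algebra K K'), FiniteDimensional K K' ∧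
      Module.finrank K K' ∣ 2 ∧ ∃ t : K', t * t = algebraMap K K' x := by
  by_cases h : ∃ t : K, t * t = x
  · obtain ⟨t, rfl⟩ := h
    exact ⟨K, inferInstance, inferInstance, inferInstance, by simp, t, rfl⟩
  · push Not at h
    have hm : (Polynomial.X ^ 2 - Polynomial.C x).Monic :=
      Polynomial.monic_X_pow_sub_C x (by norm_num)
    have hdeg : (Polynomial.X ^ 2 - Polynomial.C x).natDegree = 2 :=
      Polynomial.natDegree_X_pow_sub_C
    have hirr : Irreducible (Polynomial.X ^ 2 - Polynomial.C x) := by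
      rw [hm.irreducible_iff_roots_eq_zero_of_degree_le_three (by omega) (by omega)]
      rw [Multiset.eq_zero_iff_forall_notMem]
      intro t ht
      have := Polynomial.isRoot_of_mem_roots ht
      simp only [Polynomial.IsRoot, Polynomial.eval_sub, Polynomial.eval_pow, Polynomial.eval_X,
        Polynomial.eval_C] at this
      exact h t (by linear_combination this)
    have : Fact (Irreducible (Polynomial.X ^ 2 - Polynomial.C x)) := ⟨hirr⟩
    have hpb := AdjoinRoot.powerBasis hm.ne_zero
    refine ⟨AdjoinRoot (Polynomial.X ^ 2 - Polynomial.C x), inferInstance, inferInstance,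
      (AdjoinRoot.powerBasis hm.ne_zero).finite, ?_, AdjoinRoot.root _, ?_⟩
    · rw [(AdjoinRoot.powerBasis hm.ne_zero).finrank, AdjoinRoot.powerBasis_dim, hdeg]
    · have := AdjoinRoot.eval₂_root (Polynomial.X ^ 2 - Polynomial.C x)
      simp only [Polynomial.eval₂_sub, Polynomial.eval₂_pow, Polynomial.eval₂_X,
        Polynomial.eval₂_C] at this
      rw [AdjoinRoot.algebraMap_eq]
      linear_combination this

/-- Adjoining two square roots. -/
lemma exists_two_sqrt_ext {K : Type} [Field K] (x y : K) :
    ∃ (K' : Type) (_ : Field K') (_ : Algebra K K'), FiniteDimensional K K' ∧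
      Module.finrank K K' ∣ 8 ∧ ∃ t r : K', t * t = algebraMap K K' x ∧
        r * r = algebraMap K K' y := by
  obtain ⟨K₁, _, _, _, h₁, t, ht⟩ := exists_sqrt_ext x
  obtain ⟨K₂, _, _, _, h₂, r, hr⟩ := exists_sqrt_ext (algebraMap K K₁ y)
  letI : Algebra K K₂ := ((algebraMap K₁ K₂).comp (algebraMap K K₁)).toAlgebra
  have : IsScalarTower K K₁ K₂ := IsScalarTower.of_algebraMap_eq (fun _ => rfl)
  refine ⟨K₂, inferInstance, inferInstance, FiniteDimensional.trans K K₁ K₂, ?_,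
    algebraMap K₁ K₂ t, r, ?_, ?_⟩
  · rw [← Module.finrank_mul_finrank K K₁ K₂]
    exact (mul_dvd_mul h₁ h₂).trans (by norm_num)
  · rw [← map_mul, ht]
    rfl
  · rw [hr]
    rfl

/-- Extension of the derivation to a finite extension. -/
lemma exists_deriv_ext {K : Type} [Field K] [CharZero K] {d : K → K} (hd : IsDeriv d)
    (K' : Type) [Field K'] [Algebra K K'] [FiniteDimensional K K'] :
    ∃ d' : K' → K', IsDeriv d' ∧
      ∀ x : K, d' (algebraMap K K' x) = algebraMap K K' (d x) := by
  letI : Differential K := ⟨Derivation.mk'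
    (AddMonoidHom.toIntLinearMap ⟨⟨d, hd.map_zero'⟩, hd.1⟩) (by
      intro a b
      change d (a * b) = a * d b + b * d a
      rw [hd.2]
      ring)⟩
  letI : Differential K' := Differential.differentialFiniteDimensional K K'
  have : DifferentialAlgebra K K' := Differential.differentialAlgebraFiniteDimensional
  refine ⟨fun x => Differential.deriv x, ⟨fun x y => map_add _ x y, fun x y => ?_⟩, fun x => ?_⟩
  · change Differential.deriv (x * y) = _
    rw [Derivation.leibniz, smul_eq_mul, smul_eq_mul]
    ring
  · exact DifferentialAlgebra.deriv_algebraMap x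

open scoped TensorProduct in
/-- Extension of scalars of a differential module. -/
lemma exists_diff_ext {K : Type} [Field K] {d : K → K}
    {M : Type} [AddCommGroup M] [Module K M] {D : M → M} (hD : IsDiff d D)
    (K' : Type) [Field K'] [Algebra K K'] {d' : K' → K'} (hd' : IsDeriv d')
    (hdd : ∀ x : K, d' (algebraMap K K' x) = algebraMap K K' (d x)) :
    ∃ DM : (K' ⊗[K] M) → (K' ⊗[K] M), IsDiff d' DM ∧
      (∀ (c : K') (m : M), DM (c ⊗ₜ[K] m) = d' c ⊗ₜ[K] m + c ⊗ₜ[K] D m) := by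
  let f : K' →+ M →+ K' ⊗[K] M := AddMonoidHom.mk'
    (fun c => AddMonoidHom.mk' (fun m => d' c ⊗ₜ[K] m + c ⊗ₜ[K] D m) (by
      intro x y
      simp only [hD.1, TensorProduct.tmul_add]
      abel)) (by
      intro x y
      ext m
      simp only [AddMonoidHom.mk'_apply, AddMonoidHom.add_apply, hd'.1, TensorProduct.add_tmul]
      abel)
  have hf : ∀ c m, f c m = d' c ⊗ₜ[K] m + c ⊗ₜ[K] D m := fun _ _ => rfl
  let g := TensorProduct.liftAddHom (R := K) f (by
    intro r c m
    have h : d' (r • c) = d r • c + r • d' c := by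
      rw [Algebra.smul_def, hd'.2, hdd, ← Algebra.smul_def, ← Algebra.smul_def]
    rw [hf, hf, hD.2, h]
    simp only [TensorProduct.add_tmul, TensorProduct.tmul_add, TensorProduct.tmul_smul,
      TensorProduct.smul_tmul']
    abel)
  have hg : ∀ (c : K') (m : M), g (c ⊗ₜ[K] m) = d' c ⊗ₜ[K] m + c ⊗ₜ[K] D m := fun _ _ => rfl
  refine ⟨g, ⟨fun x y => map_add g x y, fun a m => ?_⟩, hg⟩
  induction m using TensorProduct.induction_on with
  | zero => simp
  | tmul c m =>
    rw [TensorProduct.smul_tmul', hg, hg, smul_eq_mul, hd'.2]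
    simp only [TensorProduct.add_tmul, smul_add, TensorProduct.smul_tmul', smul_eq_mul]
    abel
  | add x y hx hy =>
    rw [smul_add, map_add, hx, hy, map_add, smul_add, smul_add]
    abel

/-- The invariant form is nondegenerate by irreducibility. -/
lemma form_separating {K : Type} [Field K] {d : K → K} (hd : IsDeriv d)
    {M : Type} [AddCommGroup M] [Module K M] [FiniteDimensional K M]
    {D : M → M} (hD : IsDiff d D) (hirr : IsIrr K D)
    (B : Module.Dual K M →ₗ[K] Module.Dual K M →ₗ[K] K) (hB0 : B ≠ 0)
    (a : K)
    (hstable : ∀ φ ψ, d (B φ ψ) =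
      a * B φ ψ + B (dualD hd hD φ) ψ + B φ (dualD hd hD ψ)) :
    ∀ φ, (∀ ψ, B φ ψ = 0) → φ = 0 := by
  let R := LinearMap.ker B
  have hR : ∀ φ ∈ R, dualD hd hD φ ∈ R := by
    intro φ hφ
    have hφ' : B φ = 0 := hφ
    change B _ = 0
    ext ψ
    have := hstable φ ψ
    simp only [hφ', LinearMap.zero_apply, hd.map_zero', mul_zero, zero_add, add_zero] at this
    exact this.symm
  rcases hirr.2 R.dualCoannihilator (by
    intro x hx
    rw [Submodule.mem_dualCoannihilator] at hx ⊢
    intro φ hφ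
    have h1 := hx _ (hR φ hφ)
    have h2 : d (φ x) - φ (D x) = 0 := h1
    rw [hx φ hφ, hd.map_zero'] at h2
    linear_combination -h2) with h | h
  · exfalso
    apply hB0
    have h3 : R = ⊤ := by
      rw [← Subspace.dualCoannihilator_dualAnnihilator_eq (W := R), h]
      simp
    exact LinearMap.ker_eq_top.mp h3
  · intro φ hφ
    have hφR : φ ∈ R := by
      change B φ = 0
      ext ψ
      exact hφ ψ
    ext x
    have : x ∈ R.dualCoannihilator := by
      rw [h]
      trivial
    rw [Submodule.mem_dualCoannihilator] at this
    exact this φ hφR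

/-- Existence of a diagonalizing basis. -/
lemma exists_diag {K : Type} [Field K] [CharZero K] {d : K → K} (hd : IsDeriv d)
    {M : Type} [AddCommGroup M] [Module K M] [FiniteDimensional K M]
    (hdim : Module.finrank K M = 4)
    {D : M → M} (hD : IsDiff d D) (hirr : IsIrr K D)
    (B : Module.Dual K M →ₗ[K] Module.Dual K M →ₗ[K] K) (hB0 : B ≠ 0)
    (hsym : ∀ φ ψ, B φ ψ = B ψ φ)
    (a : K)
    (hstable : ∀ φ ψ, d (B φ ψ) =
      a * B φ ψ + B (dualD hd hD φ) ψ + B φ (dualD hd hD ψ)) :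
    ∃ (b : Basis (Fin 4) K M) (A : Fin 4 → Fin 4 → K) (s : Fin 4 → K),
      (∀ i, D (b i) = ∑ j, A j i • b j) ∧ (∀ i, s i ≠ 0) ∧
      (∀ i, d (s i) = a * s i - 2 * A i i * s i) ∧
      (∀ i j, i ≠ j → A i j * s j + A j i * s i = 0) := by
  have hsep := form_separating hd hD hirr B hB0 a hstable
  have : Invertible (2 : K) := invertibleOfNonzero two_ne_zero
  obtain ⟨v₀, hv₀⟩ := LinearMap.BilinForm.exists_orthogonal_basis (K := K)
    (V := Module.Dual K M) (B := B) ⟨fun x y => hsym x y⟩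
  have hfin : Module.finrank K (Module.Dual K M) = 4 := by
    rw [Subspace.dual_finrank_eq, hdim]
  obtain ⟨v, hv⟩ : ∃ v : Basis (Fin 4) K (Module.Dual K M), B.IsOrthoᵢ v := by
    refine ⟨v₀.reindex (finCongr hfin), fun i j hij => ?_⟩
    simp only [Function.onFun, Basis.reindex_apply]
    exact hv₀ (fun h => hij ((finCongr hfin).symm.injective h))
  let b : Basis (Fin 4) K M := v.dualBasis.map (Module.evalEquiv K M).symm
  have hvb : ∀ i j, v i (b j) = if i = j then 1 else 0 := by
    intro i j
    have : Module.evalEquiv K M (b j) (v i) = v.dualBasis j (v i) := by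
      simp [b]
    rw [Module.evalEquiv_apply] at this
    simp only [Module.Dual.eval_apply] at this
    rw [this, Basis.dualBasis_apply_self]
  have hrep : ∀ m, m = ∑ j, v j m • b j := by
    intro m
    have : ∀ j, v j m = b.repr m j := by
      intro j
      have h := congrArg (v j) (b.sum_repr m)
      rw [← h]
      simp only [map_sum, map_smul, hvb, smul_eq_mul, mul_ite, mul_one, mul_zero]
      simp
    simp only [this]
    exact (b.sum_repr m).symm
  have hdual : ∀ i, dualD hd hD (v i) = - ∑ j, v i (D (b j)) • v j := by
    intro i
    apply b.ext
    intro k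
    change d (v i (b k)) - v i (D (b k)) = _
    have : d (v i (b k)) = 0 := by
      rw [hvb]
      split_ifs
      · exact hd.map_one'
      · exact hd.map_zero'
    rw [this]
    simp [hvb]
  have hBv : ∀ i j, i ≠ j → B (v i) (v j) = 0 := fun i j hij => hv hij
  have hst : ∀ i j, d (B (v i) (v j)) = a * B (v i) (v j) - v i (D (b j)) * B (v j) (v j)
      - v j (D (b i)) * B (v i) (v i) := by
    intro i j
    rw [hstable, hdual, hdual]
    have h1 : B (-∑ k, v i (D (b k)) • v k) (v j) = - (v i (D (b j)) * B (v j) (v j)) := by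
      simp only [map_neg, map_sum, map_smul, LinearMap.neg_apply, LinearMap.sum_apply,
        LinearMap.smul_apply, smul_eq_mul]
      rw [Finset.sum_eq_single j]
      · intro k _ hk
        rw [hBv k j hk, mul_zero]
      · simp
    have h2 : B (v i) (-∑ k, v j (D (b k)) • v k) = - (v j (D (b i)) * B (v i) (v i)) := by
      simp only [map_neg, map_sum, map_smul, smul_eq_mul]
      rw [Finset.sum_eq_single i]
      · intro k _ hk
        rw [hBv i k hk.symm, mul_zero]
      · simp
    rw [h1, h2]
    ring
  refine ⟨b, fun j i => v j (D (b i)), fun i => B (v i) (v i), fun i => hrep _, ?_, ?_, ?_⟩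
  · intro i
    exact hv.not_isOrtho_basis_self_of_separatingLeft hsep i
  · intro i
    rw [hst i i]
    ring
  · intro i j hij
    have := hst i j
    rw [hBv i j hij, hd.map_zero'] at this
    linear_combination this

/-- **Proposition 6.1, positive direction.** Over a differential field
`K` all of whose finite extensions satisfy the `C₁`-type property that nondegenerate
symmetric bilinear forms in at least `3` variables have nontrivial zeros: if `M` is
an irreducible `4`-dimensional differential module with `det M = 1` such that
`Sym² M` contains a `1`-dimensional differential submodule `L` with `L^{⊗4} ≅ 1`,
then after a finite extension `K⁺ ⊇ K` of degree dividing `8`, `K⁺ ⊗ M` becomes a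
tensor product `N₁ ⊗ N₂` of two `2`-dimensional differential modules over `K⁺`. -/
theorem stmt6 {K : Type} [Field K] [CharZero K] (d : K → K) (hd : IsDeriv d)
    -- for every finite field extension K' of K, every nondegenerate symmetric
    -- bilinear form on a K'-vector space of dimension ≥ 3 has a nonzero isotropic vector
    (hK : ∀ (K' : Type) (_ : Field K') (_ : Algebra K K'), FiniteDimensional K K' →
      ∀ n : ℕ, 3 ≤ n → ∀ B : (Fin n → K') →ₗ[K'] (Fin n → K') →ₗ[K'] K',
        (∀ x y, B x y = B y x) → (∀ x, (∀ y, B x y = 0) → x = 0) →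
        ∃ x, x ≠ 0 ∧ B x x = 0)
    (M : Type) [AddCommGroup M] [Module K M] [FiniteDimensional K M]
    (hdim : Module.finrank K M = 4)
    (D : M → M) (hD : IsDiff d D) (hirr : IsIrr K D) (hdet : TraceZero K D 4)
    -- a 1-dimensional differential submodule `L = ⟨F⟩ ⊆ Sym² M` (the nonzero
    -- symmetric bilinear form `B` on `M*` spans a `∂`-stable line: `∂F = a·F`) ...
    (B : Module.Dual K M →ₗ[K] Module.Dual K M →ₗ[K] K) (hB0 : B ≠ 0)
    (hsym : ∀ φ ψ, B φ ψ = B ψ φ)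
    (a : K)
    (hstable : ∀ φ ψ, d (B φ ψ) =
      a * B φ ψ + B (dualD hd hD φ) ψ + B φ (dualD hd hD ψ))
    -- ... with `L^{⊗4} ≅ 1`, i.e. `∂(g·F^{⊗4}) = 0` for some `g ≠ 0`
    (htriv : ∃ g : K, g ≠ 0 ∧ d g + 4 * a * g = 0) :
    -- there is a finite field extension `K⁺ ⊇ K` of degree dividing 8 ...
    ∃ (K' : Type) (_ : Field K') (_ : Algebra K K'),
      FiniteDimensional K K' ∧ Module.finrank K K' ∣ 8 ∧
      -- ... with the derivation `d'` extending `d` ...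
      ∃ d' : K' → K', IsDeriv d' ∧
        (∀ x : K, d' (algebraMap K K' x) = algebraMap K K' (d x)) ∧
        -- ... the induced differential structure `DM` on `K⁺ ⊗ M` ...
        ∃ DM : (K' ⊗[K] M) → (K' ⊗[K] M), IsDiff d' DM ∧
          (∀ (c : K') (m : M), DM (c ⊗ₜ[K] m) = d' c ⊗ₜ[K] m + c ⊗ₜ[K] D m) ∧
          -- ... and 2-dimensional differential modules `N₁, N₂` over `K⁺` with
          -- `K⁺ ⊗ M ≅ N₁ ⊗ N₂` as differential modules over `K⁺`.
          ∃ DN₁ : (Fin 2 → K') → (Fin 2 → K'), ∃ DN₂ : (Fin 2 → K') → (Fin 2 → K'),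
            IsDiff d' DN₁ ∧ IsDiff d' DN₂ ∧
            ∃ β : (Fin 2 → K') →ₗ[K'] (Fin 2 → K') →ₗ[K'] (K' ⊗[K] M),
              (∀ x y, DM (β x y) = β (DN₁ x) y + β x (DN₂ y)) ∧
              Submodule.span K' {m : K' ⊗[K] M | ∃ x y, β x y = m} = ⊤ := by
  obtain ⟨b, A, s, hb, hs, hds, hA⟩ := exists_diag hd hdim hD hirr B hB0 hsym a hstable
  obtain ⟨K', _, _, hfd, hdeg, t, r, ht, hr⟩ := exists_two_sqrt_ext (-s 1 / s 0) (-s 3 / s 2)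
  obtain ⟨d', hd', hdd⟩ := exists_deriv_ext hd K'
  obtain ⟨DM, hDM, hDMt⟩ := exists_diff_ext hD K' hd' hdd
  have : CharZero K' := charZero_of_injective_algebraMap (algebraMap K K').injective
  refine ⟨K', _, _, hfd, hdeg, d', hd', hdd, DM, hDM, hDMt, ?_⟩
  have hmap : ∀ i, algebraMap K K' (s i) ≠ 0 := fun i => by
    simpa using hs i
  refine tensor_of_diag hd' hDM (fun i => (1 : K') ⊗ₜ[K] b i)
    (fun i j => algebraMap K K' (A i j)) (fun i => algebraMap K K' (s i))
    (algebraMap K K' a) t r ?_ ?_ hmap ?_ ?_ ?_ ?_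
  · intro i
    rw [hDMt, hd'.map_one', TensorProduct.zero_tmul, zero_add, hb, TensorProduct.tmul_sum]
    refine Finset.sum_congr rfl fun j _ => ?_
    rw [TensorProduct.tmul_smul, algebraMap_smul]
  · intro W hW
    rw [eq_top_iff, ← (b.baseChange K').span_eq, Submodule.span_le]
    rintro _ ⟨i, rfl⟩
    rw [Basis.baseChange_apply]
    exact hW i
  · intro i
    rw [hdd, hds]
    simp only [map_sub, map_mul, map_ofNat]
  · intro i j hij
    rw [← map_mul, ← map_mul, ← map_add, hA i j hij, map_zero]
  · rw [ht, ← map_mul, ← map_neg, div_mul_cancel₀ _ (hs 0)]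
  · rw [hr, ← map_mul, ← map_neg, div_mul_cancel₀ _ (hs 2)]
end
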